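/- Dixon's theorem: Let a, b, c be complex numbers with Re(2 + a − 2b − 2c) > 0, such that 1+a−b and 1+a−c are not nonpositive integers and none of 1+a−b, 1+a−c, 1+a/2, 1+a/2−b−c, 1+a, 1+a/2−b, 1+a/2−c, 1+a−b−c is a nonpositive integer or zero. Then ∑_{k=0}^∞ (a)_k (b)_k (c)_k / ((1+a−b)_k (1+a−c)_k k!) = Γ(1+a−b) Γ(1+a−c) Γ(1+a/2) Γ(1+a/2−b−c) / (Γ(1+a) Γ(1+a/2−b) Γ(1+a/2−c) Γ(1+a−b−c)). -/

import Mathlib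

open Complex Finset Filter Topology

/-- The Pochhammer symbol `(x)_k = x (x+1) ⋯ (x+k-1)`. -/
noncomputable def poch (x : ℂ) (k : ℕ) : ℂ := (ascPochhammer ℂ k).eval x

theorem poch_zero (x : ℂ) : poch x 0 = 1 := by simp [poch]

theorem poch_succ (x : ℂ) (k : ℕ) : poch x (k + 1) = poch x k * (x + k) := by
  simp [poch, ascPochhammer_succ_eval]

theorem poch_ne_zero {x : ℂ} (hx : ∀ m : ℕ, x ≠ -(m : ℂ)) (k : ℕ) : poch x k ≠ 0 := by
  induction k with
  | zero => simp [poch_zero]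
  | succ k ih =>
    rw [poch_succ]
    exact mul_ne_zero ih fun h => hx k (eq_neg_of_add_eq_zero_left h)

theorem poch_eq_prod (x : ℂ) (k : ℕ) : poch x k = ∏ j ∈ range k, (x + j) := by
  induction k with
  | zero => simp [poch_zero]
  | succ k ih => rw [poch_succ, prod_range_succ, ih]

theorem poch_one (k : ℕ) : poch 1 k = (Nat.factorial k : ℂ) := by
  simp [poch, ascPochhammer_eval_one]

theorem poch_add_one (x : ℂ) (k : ℕ) : x * poch (x + 1) k = poch x k * (x + k) := by
  induction k with
  | zero => simp [poch_zero]
  | succ k ih =>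
    rw [poch_succ, poch_succ, ← mul_assoc, ih]
    push_cast
    ring

theorem poch_add_two (x : ℂ) (k : ℕ) :
    x * (x + 1) * poch (x + 2) k = poch x k * (x + k) * (x + 1 + k) := by
  have h := poch_add_one (x + 1) k
  rw [show x + 1 + 1 = x + 2 by ring] at h
  linear_combination x * h + (x + 1 + k) * poch_add_one x k

theorem gammaSeq_eq_div_poch (x : ℂ) (m : ℕ) :
    GammaSeq x m = (m : ℂ) ^ x * (Nat.factorial m : ℂ) / poch x (m + 1) := by
  rw [GammaSeq, poch_eq_prod]

theorem poch_eq_div_gammaSeq (x : ℂ) {m : ℕ} (hm : m ≠ 0) :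
    poch x (m + 1) = (m : ℂ) ^ x * (Nat.factorial m : ℂ) / GammaSeq x m := by
  have h : (m : ℂ) ^ x * (Nat.factorial m : ℂ) ≠ 0 :=
    mul_ne_zero (by simp [cpow_eq_zero_iff, hm]) (by exact_mod_cast m.factorial_ne_zero)
  rw [gammaSeq_eq_div_poch, div_div_cancel₀ h]

theorem poch_isBigO (x : ℂ) :
    (fun m : ℕ => poch x (m + 1)) =O[atTop]
      fun m : ℕ => (m : ℝ) ^ x.re * (Nat.factorial m : ℝ) := by
  by_cases hx : ∀ m : ℕ, x ≠ -(m : ℂ)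
  · have h1 : (fun m : ℕ => (GammaSeq x m)⁻¹) =O[atTop] fun _ => (1 : ℝ) :=
      ((GammaSeq_tendsto_Gamma x).inv₀ (Gamma_ne_zero hx)).isBigO_one ℝ
    have h2 : (fun m : ℕ => (m : ℂ) ^ x * (Nat.factorial m : ℂ)) =O[atTop]
        fun m : ℕ => (m : ℝ) ^ x.re * (Nat.factorial m : ℝ) := by
      refine Asymptotics.IsBigO.of_bound 1 ?_
      filter_upwards [eventually_gt_atTop 0] with m hm
      simp [norm_natCast_cpow_of_pos hm, abs_of_nonneg (Real.rpow_nonneg m.cast_nonneg x.re)]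
    refine ((h2.mul h1).congr' ?_ ?_)
    · filter_upwards [eventually_ne_atTop 0] with m hm
      rw [poch_eq_div_gammaSeq x hm, div_eq_mul_inv]
    · exact .of_forall fun m => mul_one _
  · push Not at hx
    obtain ⟨n, rfl⟩ := hx
    refine Asymptotics.IsBigO.of_bound 1 ?_
    filter_upwards [eventually_ge_atTop n] with m hm
    rw [poch_eq_prod, prod_eq_zero (i := n) (by simp; lia) (by simp)]
    simp only [norm_zero]
    positivity

theorem poch_inv_isBigO (x : ℂ) :
    (fun m : ℕ => (poch x (m + 1))⁻¹) =O[atTop]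
      fun m : ℕ => ((m : ℝ) ^ x.re * (Nat.factorial m : ℝ))⁻¹ := by
  have h1 : (fun m : ℕ => GammaSeq x m) =O[atTop] fun _ => (1 : ℝ) :=
    (GammaSeq_tendsto_Gamma x).isBigO_one ℝ
  have h2 : (fun m : ℕ => ((m : ℂ) ^ x * (Nat.factorial m : ℂ))⁻¹) =O[atTop]
      fun m : ℕ => ((m : ℝ) ^ x.re * (Nat.factorial m : ℝ))⁻¹ := by
    refine Asymptotics.IsBigO.of_bound 1 ?_
    filter_upwards [eventually_gt_atTop 0] with m hm
    simp [norm_natCast_cpow_of_pos hm, abs_of_nonneg (Real.rpow_nonneg m.cast_nonneg x.re)]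
  refine (h2.mul h1).congr' ?_ (.of_forall fun m => mul_one _)
  filter_upwards [eventually_ne_atTop 0] with m hm
  rw [poch_eq_div_gammaSeq x hm, inv_div, div_eq_mul_inv, mul_comm]

theorem tendsto_poch_ratio {u v w z : ℂ} (hw : ∀ m : ℕ, w ≠ -(m : ℂ))
    (hz : ∀ m : ℕ, z ≠ -(m : ℂ)) (h : u + v = w + z) :
    Tendsto (fun m : ℕ => poch w (m + 1) * poch z (m + 1) / (poch u (m + 1) * poch v (m + 1)))
      atTop (𝓝 (Gamma u * Gamma v / (Gamma w * Gamma z))) := by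
  refine (((GammaSeq_tendsto_Gamma u).mul (GammaSeq_tendsto_Gamma v)).div
    ((GammaSeq_tendsto_Gamma w).mul (GammaSeq_tendsto_Gamma z))
    (mul_ne_zero (Gamma_ne_zero hw) (Gamma_ne_zero hz))).congr' ?_
  filter_upwards [eventually_ne_atTop 0] with m hm
  have hm' : (m : ℂ) ≠ 0 := by exact_mod_cast hm
  have hf : (Nat.factorial m : ℂ) ≠ 0 := by exact_mod_cast m.factorial_ne_zero
  have hp (x : ℂ) : (m : ℂ) ^ x ≠ 0 := by simp [cpow_eq_zero_iff, hm]
  have hwz : (m : ℂ) ^ u * (m : ℂ) ^ v = (m : ℂ) ^ w * (m : ℂ) ^ z := by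
    rw [← cpow_add _ _ hm', ← cpow_add _ _ hm', h]
  have hne : (m : ℂ) ^ w * (m : ℂ) ^ z * (Nat.factorial m : ℂ) ^ 2 ≠ 0 :=
    mul_ne_zero (mul_ne_zero (hp w) (hp z)) (pow_ne_zero 2 hf)
  have e1 : (m : ℂ) ^ u * (Nat.factorial m : ℂ) * ((m : ℂ) ^ v * (Nat.factorial m : ℂ)) =
      (m : ℂ) ^ w * (m : ℂ) ^ z * (Nat.factorial m : ℂ) ^ 2 := by
    rw [← hwz]; ring
  have e2 : (m : ℂ) ^ w * (Nat.factorial m : ℂ) * ((m : ℂ) ^ z * (Nat.factorial m : ℂ)) =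
      (m : ℂ) ^ w * (m : ℂ) ^ z * (Nat.factorial m : ℂ) ^ 2 := by ring
  simp only [gammaSeq_eq_div_poch, Pi.div_apply, div_mul_div_comm, e1, e2]
  exact div_div_div_cancel_left' _ _ hne

/-- The general term of the hypergeometric series `₃F₂(a,b,c; d,e; 1)`. -/
noncomputable def hyp (a b c d e : ℂ) (k : ℕ) : ℂ :=
  poch a k * poch b k * poch c k / (poch d k * poch e k * (Nat.factorial k : ℂ))

theorem hyp_zero (a b c d e : ℂ) : hyp a b c d e 0 = 1 := by simp [hyp, poch_zero]

theorem hyp_isBigO (a b c d e : ℂ) :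
    (fun m : ℕ => hyp a b c d e (m + 1)) =O[atTop]
      fun m : ℕ => (m : ℝ) ^ ((a + b + c - d - e).re - 1) := by
  have h := (((poch_isBigO a).mul (poch_isBigO b)).mul (poch_isBigO c)).mul
    (((poch_inv_isBigO d).mul (poch_inv_isBigO e)).mul (poch_inv_isBigO 1))
  refine h.congr' (.of_forall fun m => ?_) ?_
  · simp only [hyp, poch_one, div_eq_mul_inv, mul_inv]
  · filter_upwards [eventually_gt_atTop 0] with m hm
    have hm' : (0 : ℝ) < m := by exact_mod_cast hm
    have hf : (Nat.factorial m : ℝ) ≠ 0 := by exact_mod_cast m.factorial_ne_zero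
    have e1 : (m : ℝ) ^ ((a + b + c - d - e).re - 1) =
        (m : ℝ) ^ a.re * (m : ℝ) ^ b.re * (m : ℝ) ^ c.re /
          ((m : ℝ) ^ d.re * (m : ℝ) ^ e.re * (m : ℝ) ^ (1 : ℂ).re) := by
      rw [← Real.rpow_add hm', ← Real.rpow_add hm', ← Real.rpow_add hm', ← Real.rpow_add hm',
        ← Real.rpow_sub hm']
      congr 1
      simp
      ring
    rw [e1]
    have := (Real.rpow_pos_of_pos hm' d.re).ne'
    have := (Real.rpow_pos_of_pos hm' e.re).ne'
    have := (Real.rpow_pos_of_pos hm' (1 : ℂ).re).ne'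
    field_simp

theorem summable_hyp {a b c d e : ℂ} (h : 0 < (d + e - a - b - c).re) :
    Summable (hyp a b c d e) := by
  rw [← summable_nat_add_iff 1]
  refine summable_of_isBigO_nat (Real.summable_nat_rpow.2 ?_) (hyp_isBigO a b c d e)
  simp at h ⊢
  linarith

theorem tendsto_mul_hyp {a b c d e : ℂ} (h : 0 < (d + e - a - b - c).re) :
    Tendsto (fun m : ℕ => (m : ℂ) * hyp a b c d e (m + 1)) atTop (𝓝 0) := by
  have h1 : (fun m : ℕ => (m : ℂ)) =O[atTop] fun m : ℕ => (m : ℝ) :=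
    Asymptotics.IsBigO.of_bound 1 (.of_forall fun m => by simp)
  refine (h1.mul (hyp_isBigO a b c d e)).trans_tendsto ?_
  have h2 := (tendsto_rpow_neg_atTop h).comp tendsto_natCast_atTop_atTop
  refine h2.congr' ?_
  filter_upwards [eventually_gt_atTop 0] with m hm
  have hm' : (0 : ℝ) < m := by exact_mod_cast hm
  simp only [Function.comp]
  nth_rw 2 [← Real.rpow_one (m : ℝ)]
  rw [← Real.rpow_add hm']
  congr 1
  simp
  ring

theorem norm_poch_le (x : ℂ) (k : ℕ) : ‖poch x k‖ ≤ ‖poch (‖x‖ : ℂ) k‖ := by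
  rw [poch_eq_prod, poch_eq_prod, norm_prod, norm_prod]
  refine prod_le_prod (fun _ _ => norm_nonneg _) fun j _ => ?_
  have h : ‖(‖x‖ : ℂ) + j‖ = ‖x‖ + j := by
    rw [← ofReal_natCast, ← ofReal_add, Complex.norm_of_nonneg (by positivity)]
  rw [h]
  simpa using norm_add_le x j

theorem norm_poch_mul_le {x b c : ℂ} {L : ℝ} (hL : 0 ≤ L)
    (h : L + ‖1 - b‖ + ‖1 - c‖ ≤ x.re) (k : ℕ) :
    ‖poch x k‖ * ‖poch (L : ℂ) k‖ ≤ ‖poch (1 + x - b) k‖ * ‖poch (1 + x - c) k‖ := by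
  simp only [poch_eq_prod, norm_prod, ← prod_mul_distrib]
  refine prod_le_prod (fun _ _ => by positivity) fun j _ => ?_
  have e1 : ‖(L : ℂ) + j‖ = L + j := by
    rw [← ofReal_natCast, ← ofReal_add, Complex.norm_of_nonneg (by positivity)]
  have hy : x.re + j ≤ ‖x + j‖ := by simpa using re_le_norm (x + j)
  have hb : ‖x + j‖ - ‖1 - b‖ ≤ ‖1 + x - b + j‖ := by
    have := norm_sub_le_norm_add (x + j) (1 - b)
    rwa [show x + j + (1 - b) = 1 + x - b + j by ring] at this
  have hc : ‖x + j‖ - ‖1 - c‖ ≤ ‖1 + x - c + j‖ := by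
    have := norm_sub_le_norm_add (x + j) (1 - c)
    rwa [show x + j + (1 - c) = 1 + x - c + j by ring] at this
  have hB := norm_nonneg (1 - b)
  have hC := norm_nonneg (1 - c)
  have hj : (0 : ℝ) ≤ j := j.cast_nonneg
  rw [e1]
  calc ‖x + j‖ * (L + j) ≤ ‖x + j‖ * (‖x + j‖ - ‖1 - b‖ - ‖1 - c‖) := by gcongr; linarith
    _ ≤ (‖x + j‖ - ‖1 - b‖) * (‖x + j‖ - ‖1 - c‖) := by nlinarith [mul_nonneg hB hC]
    _ ≤ _ := by gcongr; linarith

theorem poch_ofReal_ne_zero {L : ℝ} (hL : 0 < L) (k : ℕ) : poch (L : ℂ) k ≠ 0 := by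
  refine poch_ne_zero (fun m hm => ?_) k
  have := congrArg re hm
  simp at this
  linarith [(m.cast_nonneg : (0 : ℝ) ≤ m)]

theorem le_norm_poch_succ {L : ℝ} (hL : 1 ≤ L) (k : ℕ) : L ≤ ‖poch (L : ℂ) (k + 1)‖ := by
  induction k with
  | zero => simp [poch_succ, poch_zero, le_abs_self]
  | succ k ih =>
    rw [poch_succ, norm_mul]
    have : 1 ≤ ‖(L : ℂ) + (k + 1 : ℕ)‖ := by
      rw [← ofReal_natCast, ← ofReal_add, Complex.norm_of_nonneg (by positivity)]
      linarith [((k + 1).cast_nonneg : (0 : ℝ) ≤ (k + 1 : ℕ))]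
    nlinarith

theorem norm_hyp_le {x b c : ℂ} {L : ℝ} (hL : 0 < L) (h : L + ‖1 - b‖ + ‖1 - c‖ ≤ x.re)
    (k : ℕ) :
    ‖hyp x b c (1 + x - b) (1 + x - c) k‖ ≤
      ‖hyp 1 ‖b‖ ‖c‖ L 1 k‖ := by
  have hx := norm_poch_mul_le hL.le h k
  have hLk : 0 < ‖poch (L : ℂ) k‖ := norm_pos_iff.2 (poch_ofReal_ne_zero hL k)
  have hf : (0 : ℝ) < Nat.factorial k := by exact_mod_cast k.factorial_pos
  have hb := norm_poch_le b k
  have hc := norm_poch_le c k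
  have key : ‖poch x k‖ / (‖poch (1 + x - b) k‖ * ‖poch (1 + x - c) k‖) ≤ 1 / ‖poch (L : ℂ) k‖ := by
    rw [le_div_iff₀ hLk, div_mul_eq_mul_div]
    exact div_le_one_of_le₀ hx (by positivity)
  simp only [hyp, poch_one, norm_mul, norm_div, norm_natCast]
  calc _ = ‖poch x k‖ / (‖poch (1 + x - b) k‖ * ‖poch (1 + x - c) k‖) *
        (‖poch b k‖ * ‖poch c k‖) / Nat.factorial k := by
        simp only [div_eq_mul_inv, mul_inv]; ring
    _ ≤ 1 / ‖poch (L : ℂ) k‖ * (‖poch (‖b‖ : ℂ) k‖ * ‖poch (‖c‖ : ℂ) k‖) / Nat.factorial k := by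
        gcongr
    _ = _ := by field_simp

theorem tendsto_tsum_hyp (a b c : ℂ) :
    Tendsto (fun n : ℕ => ∑' k, hyp (a + 2 * n) b c (1 + (a + 2 * n) - b) (1 + (a + 2 * n) - c) k)
      atTop (𝓝 1) := by
  have hre : Tendsto (fun n : ℕ => (a + 2 * n).re - ‖1 - b‖ - ‖1 - c‖) atTop atTop := by
    have h : Tendsto (fun n : ℕ => (2 : ℝ) * n + (a.re - ‖1 - b‖ - ‖1 - c‖)) atTop atTop :=
      tendsto_atTop_add_const_right _ _
        (tendsto_natCast_atTop_atTop.const_mul_atTop (by norm_num))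
    refine h.congr fun n => ?_
    simp
    ring
  have hlim : ∑' k : ℕ, (if k = 0 then (1 : ℂ) else 0) = 1 := tsum_ite_eq 0 _
  rw [show 𝓝 (1 : ℂ) = 𝓝 (∑' k : ℕ, if k = 0 then (1 : ℂ) else 0) by rw [hlim]]
  set L : ℝ := ‖b‖ + ‖c‖ + 1 with hL
  have hLpos : 0 < L := by positivity
  refine tendsto_tsum_of_dominated_convergence
    (bound := fun k => ‖hyp 1 ‖b‖ ‖c‖ L 1 k‖) ?_ ?_ ?_
  · refine (summable_hyp ?_).norm
    simp [hL]
    linarith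
  · rintro (_ | k)
    · simp [hyp_zero]
    · simp only [Nat.add_eq_zero_iff, one_ne_zero, and_false, if_false]
      set K : ℝ := ‖poch (‖b‖ : ℂ) (k + 1)‖ * ‖poch (‖c‖ : ℂ) (k + 1)‖ / Nat.factorial (k + 1)
      have hK : Tendsto (fun n : ℕ => K / ((a + 2 * n).re - ‖1 - b‖ - ‖1 - c‖)) atTop (𝓝 0) :=
        hre.const_div_atTop K
      refine squeeze_zero_norm' ?_ hK
      filter_upwards [hre.eventually_ge_atTop 1] with n hn
      have hx : (a + 2 * n).re - ‖1 - b‖ - ‖1 - c‖ + ‖1 - b‖ + ‖1 - c‖ ≤ (a + 2 * n).re := by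
        linarith
      refine (norm_hyp_le (zero_lt_one.trans_le hn) hx (k + 1)).trans ?_
      have h1 := le_norm_poch_succ hn k
      generalize (a + 2 * n).re - ‖1 - b‖ - ‖1 - c‖ = M at *
      have hf : (0 : ℝ) < Nat.factorial (k + 1) := by exact_mod_cast (k + 1).factorial_pos
      calc ‖hyp 1 ‖b‖ ‖c‖ M 1 (k + 1)‖ = K / ‖poch (M : ℂ) (k + 1)‖ := by
            simp only [hyp, poch_one, norm_mul, norm_div, norm_natCast, K]
            field_simp
        _ ≤ K / M := by gcongr
  · filter_upwards [hre.eventually_ge_atTop L] with n hn k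
    have hx : L + ‖1 - b‖ + ‖1 - c‖ ≤ (a + 2 * n).re := by linarith
    exact norm_hyp_le hLpos hx k

/-- The polynomial factor of the Wilf–Zeilberger certificate of Dixon's series. -/
noncomputable def dixonPoly (a b c k : ℂ) : ℂ :=
  -(a / 2) * (k + a) * (k + a + 1) - a * (1 + a / 2 - b - c) * (k + a) +
    (1 + a / 2 - b - c) * (1 - b) * (1 - c)

/-- The Wilf–Zeilberger companion of Dixon's series for the shift `a ↦ a + 2`. -/
noncomputable def dixonCert (a b c : ℂ) (k : ℕ) : ℂ :=
  k * dixonPoly a b c k * hyp a b c (1 + a - b) (1 + a - c) k /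
    ((1 + a - b + k) * (1 + a - c + k))

theorem dixonCert_sub {a b c : ℂ} (hb : ∀ m : ℕ, 1 + a - b ≠ -(m : ℂ))
    (hc : ∀ m : ℕ, 1 + a - c ≠ -(m : ℂ)) (ha : a ≠ 0) (ha' : a + 1 ≠ 0) (k : ℕ) :
    dixonCert a b c (k + 1) - dixonCert a b c k =
      a * (1 + a / 2 - b - c) * hyp a b c (1 + a - b) (1 + a - c) k -
      2 * (1 + a / 2 - b) * (1 + a / 2 - c) * (1 + a - b - c) * (2 + a - b - c) * (a * (a + 1)) /
        ((1 + a - b) * (2 + a - b) * (1 + a - c) * (2 + a - c)) *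
        hyp (a + 2) b c (1 + (a + 2) - b) (1 + (a + 2) - c) k := by
  have nz {x : ℂ} (hx : ∀ m : ℕ, x ≠ -(m : ℂ)) (m : ℕ) : x + m ≠ 0 := fun h =>
    hx m (eq_neg_of_add_eq_zero_left h)
  have hb0 : 1 + a - b ≠ 0 := by simpa using hb 0
  have hc0 : 1 + a - c ≠ 0 := by simpa using hc 0
  have hb1 : 2 + a - b ≠ 0 := by
    convert nz hb 1 using 1; push_cast; ring
  have hc1 : 2 + a - c ≠ 0 := by
    convert nz hc 1 using 1; push_cast; ring
  have hbk := nz hb k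
  have hck := nz hc k
  have hbk1 : 2 + a - b + k ≠ 0 := by
    convert nz hb (k + 1) using 1; push_cast; ring
  have hck1 : 2 + a - c + k ≠ 0 := by
    convert nz hc (k + 1) using 1; push_cast; ring
  have hpb := poch_ne_zero hb k
  have hpc := poch_ne_zero hc k
  have hf : (Nat.factorial k : ℂ) ≠ 0 := by exact_mod_cast k.factorial_ne_zero
  have hk1 : (k : ℂ) + 1 ≠ 0 := by exact_mod_cast k.succ_ne_zero
  have ea : poch (a + 2) k = poch a k * (a + k) * (a + 1 + k) / (a * (a + 1)) := by
    rw [eq_div_iff (mul_ne_zero ha ha'), ← poch_add_two]; ring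
  have eb : poch (1 + (a + 2) - b) k =
      poch (1 + a - b) k * (1 + a - b + k) * (2 + a - b + k) / ((1 + a - b) * (2 + a - b)) := by
    rw [eq_div_iff (mul_ne_zero hb0 hb1)]
    have := poch_add_two (1 + a - b) k
    rw [show 1 + (a + 2) - b = 1 + a - b + 2 by ring]
    linear_combination this
  have ec : poch (1 + (a + 2) - c) k =
      poch (1 + a - c) k * (1 + a - c + k) * (2 + a - c + k) / ((1 + a - c) * (2 + a - c)) := by
    rw [eq_div_iff (mul_ne_zero hc0 hc1)]
    have := poch_add_two (1 + a - c) k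
    rw [show 1 + (a + 2) - c = 1 + a - c + 2 by ring]
    linear_combination this
  have hs : hyp a b c (1 + a - b) (1 + a - c) (k + 1) = hyp a b c (1 + a - b) (1 + a - c) k *
      ((a + k) * (b + k) * (c + k) / ((1 + a - b + k) * (1 + a - c + k) * (k + 1))) := by
    simp only [hyp, poch_succ, Nat.factorial_succ]
    push_cast
    field_simp
  have ht : hyp (a + 2) b c (1 + (a + 2) - b) (1 + (a + 2) - c) k =
      hyp a b c (1 + a - b) (1 + a - c) k *
      ((a + k) * (a + 1 + k) / (a * (a + 1)) *
        ((1 + a - b) * (2 + a - b) * (1 + a - c) * (2 + a - c)) /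
        ((1 + a - b + k) * (2 + a - b + k) * (1 + a - c + k) * (2 + a - c + k))) := by
    simp only [hyp, ea, eb, ec]
    field_simp
  simp only [dixonCert, hs, ht, dixonPoly]
  generalize hyp a b c (1 + a - b) (1 + a - c) k = T
  push_cast
  rw [show 1 + a - b + ((k : ℂ) + 1) = 2 + a - b + k by ring,
    show 1 + a - c + ((k : ℂ) + 1) = 2 + a - c + k by ring]
  field_simp
  ring

theorem tendsto_dixonCert {a b c : ℂ} (h : 0 < (2 + a - 2 * b - 2 * c).re) :
    Tendsto (dixonCert a b c) atTop (𝓝 0) := by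
  rw [← tendsto_add_atTop_iff_nat 1]
  have h1 : Tendsto (fun m : ℕ => (m : ℂ) * hyp a b c (1 + a - b) (1 + a - c) (m + 1))
      atTop (𝓝 0) := tendsto_mul_hyp (by convert h using 2; ring)
  set f : ℂ → ℂ := fun u => (1 + u) *
    (-(a / 2) * (1 + (1 + a) * u) * (1 + (2 + a) * u) -
      a * (1 + a / 2 - b - c) * (1 + (1 + a) * u) * u +
      (1 + a / 2 - b - c) * (1 - b) * (1 - c) * u ^ 2) /
      ((1 + (2 + a - b) * u) * (1 + (2 + a - c) * u)) with hf
  have hcont : ContinuousAt f 0 := by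
    refine ContinuousAt.div (by fun_prop) (by fun_prop) (by simp)
  have h2 : Tendsto (fun m : ℕ => f (m : ℂ)⁻¹) atTop (𝓝 (f 0)) :=
    hcont.tendsto.comp tendsto_inv_atTop_nhds_zero_nat
  have h3 := h1.mul h2
  rw [zero_mul] at h3
  refine h3.congr' ?_
  filter_upwards [eventually_ne_atTop 0] with m hm
  have hm' : (m : ℂ) ≠ 0 := by exact_mod_cast hm
  have e1 : 1 + a - b + ((m : ℂ) + 1) = m * (1 + (2 + a - b) * (m : ℂ)⁻¹) := by
    field_simp; ring
  have e2 : 1 + a - c + ((m : ℂ) + 1) = m * (1 + (2 + a - c) * (m : ℂ)⁻¹) := by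
    field_simp; ring
  have e3 : ((m : ℂ) + 1) * dixonPoly a b c (m + 1) = m ^ 3 * ((1 + (m : ℂ)⁻¹) *
      (-(a / 2) * (1 + (1 + a) * (m : ℂ)⁻¹) * (1 + (2 + a) * (m : ℂ)⁻¹) -
      a * (1 + a / 2 - b - c) * (1 + (1 + a) * (m : ℂ)⁻¹) * (m : ℂ)⁻¹ +
      (1 + a / 2 - b - c) * (1 - b) * (1 - c) * (m : ℂ)⁻¹ ^ 2)) := by
    rw [dixonPoly]
    field_simp
    ring
  simp only [dixonCert, hf]
  push_cast
  rw [e1, e2, e3]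
  generalize 1 + (2 + a - b) * (m : ℂ)⁻¹ = X
  generalize 1 + (2 + a - c) * (m : ℂ)⁻¹ = Y
  generalize (1 + (m : ℂ)⁻¹) * _ = Z
  field_simp

theorem tsum_hyp_add_two {a b c : ℂ} (h : 0 < (2 + a - 2 * b - 2 * c).re)
    (hb : ∀ m : ℕ, 1 + a - b ≠ -(m : ℂ))
    (hc : ∀ m : ℕ, 1 + a - c ≠ -(m : ℂ)) (hw : 1 + a / 2 - b - c ≠ 0)
    (ha : a ≠ 0) (ha' : 1 + a ≠ 0) :
    ∑' k, hyp a b c (1 + a - b) (1 + a - c) k =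
      2 * (1 + a / 2 - b) * (1 + a / 2 - c) * (1 + a - b - c) * (2 + a - b - c) * (1 + a) /
        ((1 + a - b) * (2 + a - b) * (1 + a - c) * (2 + a - c) * (1 + a / 2 - b - c)) *
      ∑' k, hyp (a + 2) b c (1 + (a + 2) - b) (1 + (a + 2) - c) k := by
  have s1 : Summable (hyp a b c (1 + a - b) (1 + a - c)) :=
    summable_hyp (by convert h using 2; ring)
  have s2 : Summable (hyp (a + 2) b c (1 + (a + 2) - b) (1 + (a + 2) - c)) := by
    refine summable_hyp ?_
    simp at h ⊢
    linarith
  have hs := (s1.hasSum.mul_left (a * (1 + a / 2 - b - c))).sub (s2.hasSum.mul_left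
    (2 * (1 + a / 2 - b) * (1 + a / 2 - c) * (1 + a - b - c) * (2 + a - b - c) * (a * (a + 1)) /
        ((1 + a - b) * (2 + a - b) * (1 + a - c) * (2 + a - c))))
  have ht := hs.tendsto_sum_nat
  simp only [← dixonCert_sub hb hc ha (by rwa [add_comm]), sum_range_sub] at ht
  have h0 : dixonCert a b c 0 = 0 := by simp [dixonCert]
  simp only [h0, sub_zero] at ht
  have key := sub_eq_zero.1 (tendsto_nhds_unique ht (tendsto_dixonCert h))
  refine mul_left_cancel₀ (mul_ne_zero ha hw) (key.trans ?_)
  generalize 2 * (1 + a / 2 - b) * (1 + a / 2 - c) * (1 + a - b - c) * (2 + a - b - c) = N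
  generalize (1 + a - b) * (2 + a - b) * (1 + a - c) * (2 + a - c) = D
  generalize 1 + a / 2 - b - c = W at hw
  generalize ∑' k, hyp (a + 2) b c (1 + (a + 2) - b) (1 + (a + 2) - c) k = T
  simp only [div_eq_mul_inv, mul_inv]
  linear_combination -(N * (a * (a + 1)) * D⁻¹ * T) * mul_inv_cancel₀ hw

theorem tsum_hyp_add_two_mul {a b c : ℂ} (h : 0 < (2 + a - 2 * b - 2 * c).re)
    (hb : ∀ m : ℕ, 1 + a - b ≠ -(m : ℂ))
    (hc : ∀ m : ℕ, 1 + a - c ≠ -(m : ℂ)) (h3 : ∀ m : ℕ, 1 + a / 2 ≠ -(m : ℂ))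
    (h4 : ∀ m : ℕ, 1 + a / 2 - b - c ≠ -(m : ℂ))
    (ha : a ≠ 0) (h5 : ∀ m : ℕ, 1 + a ≠ -(m : ℂ)) (n : ℕ) :
    ∑' k, hyp a b c (1 + a - b) (1 + a - c) k =
      poch (1 + a) (2 * n) * poch (1 + a - b - c) (2 * n) /
        (poch (1 + a - b) (2 * n) * poch (1 + a - c) (2 * n)) *
      (poch (1 + a / 2 - b) n * poch (1 + a / 2 - c) n /
        (poch (1 + a / 2) n * poch (1 + a / 2 - b - c) n)) *
      ∑' k, hyp (a + 2 * n) b c (1 + (a + 2 * n) - b) (1 + (a + 2 * n) - c) k := by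
  have nz {x : ℂ} (hx : ∀ m : ℕ, x ≠ -(m : ℂ)) (m : ℕ) : x + m ≠ 0 := fun h =>
    hx m (eq_neg_of_add_eq_zero_left h)
  induction n with
  | zero => simp [poch_zero]
  | succ n ih =>
    have hstep := tsum_hyp_add_two (a := a + 2 * n) (b := b) (c := c)
      (by simp at h ⊢; linarith [(n.cast_nonneg : (0 : ℝ) ≤ n)])
      (fun m hm => hb (2 * n + m) (by push_cast; linear_combination hm))
      (fun m hm => hc (2 * n + m) (by push_cast; linear_combination hm))
      (fun hm => h4 n (by linear_combination hm))
      (fun hm => by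
        rcases n with _ | n
        · exact ha (by simpa using hm)
        · exact h5 (2 * n + 1) (by push_cast at hm ⊢; linear_combination hm))
      (fun hm => h5 (2 * n) (by push_cast; linear_combination hm))
    have h3n := nz h3 n
    have hρ : 2 * (1 + (a + 2 * n) / 2 - b) * (1 + (a + 2 * n) / 2 - c) *
          (1 + (a + 2 * n) - b - c) * (2 + (a + 2 * n) - b - c) * (1 + (a + 2 * n)) /
        ((1 + (a + 2 * n) - b) * (2 + (a + 2 * n) - b) * (1 + (a + 2 * n) - c) *
          (2 + (a + 2 * n) - c) * (1 + (a + 2 * n) / 2 - b - c)) =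
        (1 + a + 2 * n) * (1 + a + (2 * n + 1)) *
          ((1 + a - b - c + 2 * n) * (1 + a - b - c + (2 * n + 1))) /
          ((1 + a - b + 2 * n) * (1 + a - b + (2 * n + 1)) *
            ((1 + a - c + 2 * n) * (1 + a - c + (2 * n + 1)))) *
          ((1 + a / 2 - b + n) * (1 + a / 2 - c + n) /
            ((1 + a / 2 + n) * (1 + a / 2 - b - c + n))) := by
      rw [show 1 + (a + 2 * n) / 2 - b - c = 1 + a / 2 - b - c + n by ring,
        show 1 + (a + 2 * n) / 2 - b = 1 + a / 2 - b + n by ring,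
        show 1 + (a + 2 * n) / 2 - c = 1 + a / 2 - c + n by ring,
        show 1 + (a + 2 * n) - b - c = 1 + a - b - c + 2 * n by ring,
        show 2 + (a + 2 * n) - b - c = 1 + a - b - c + (2 * n + 1) by ring,
        show 1 + (a + 2 * n) - b = 1 + a - b + 2 * n by ring,
        show 2 + (a + 2 * n) - b = 1 + a - b + (2 * n + 1) by ring,
        show 1 + (a + 2 * n) - c = 1 + a - c + 2 * n by ring,
        show 2 + (a + 2 * n) - c = 1 + a - c + (2 * n + 1) by ring,
        show 1 + (a + 2 * n) = 1 + a + 2 * n by ring,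
        show 1 + a + (2 * (n : ℂ) + 1) = 2 * (1 + a / 2 + n) by ring]
      generalize 1 + a / 2 - b - c + (n : ℂ) = x1
      generalize 1 + a / 2 - b + (n : ℂ) = x2
      generalize 1 + a / 2 - c + (n : ℂ) = x3
      generalize 1 + a - b - c + 2 * (n : ℂ) = x4
      generalize 1 + a - b - c + (2 * (n : ℂ) + 1) = x5
      generalize 1 + a - b + 2 * (n : ℂ) = x6
      generalize 1 + a - b + (2 * (n : ℂ) + 1) = x7
      generalize 1 + a - c + 2 * (n : ℂ) = x8
      generalize 1 + a - c + (2 * (n : ℂ) + 1) = x9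
      generalize 1 + a + 2 * (n : ℂ) = x10
      generalize 1 + a / 2 + (n : ℂ) = x11 at *
      simp only [div_eq_mul_inv, mul_inv]
      linear_combination -(2 * x2 * x3 * x4 * x5 * x10 *
        (x6⁻¹ * x7⁻¹ * x8⁻¹ * x9⁻¹ * x1⁻¹)) * mul_inv_cancel₀ h3n
    rw [ih, hstep, hρ]
    rw [show 2 * (n + 1) = 2 * n + 1 + 1 by ring,
      show a + 2 * (n : ℂ) + 2 = a + 2 * ((n + 1 : ℕ) : ℂ) by push_cast; ring]
    simp only [poch_succ]
    rw [show ((2 * n + 1 : ℕ) : ℂ) = 2 * n + 1 by push_cast; ring,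
      show ((2 * n : ℕ) : ℂ) = 2 * n by push_cast; ring, ← mul_assoc]
    congr 1
    simp only [div_mul_div_comm]
    congr 1 <;> ring

/-- Dixon's theorem: for `Re(2+a-2b-2c) > 0`,
`₃F₂(a,b,c; 1+a-b, 1+a-c; 1)
  = Γ(1+a-b) Γ(1+a-c) Γ(1+a/2) Γ(1+a/2-b-c) / (Γ(1+a) Γ(1+a/2-b) Γ(1+a/2-c) Γ(1+a-b-c))`. -/
theorem dixon_theorem (a b c : ℂ) (h : (2 + a - 2 * b - 2 * c).re > 0)
    (h1 : ∀ m : ℕ, 1 + a - b ≠ -(m : ℂ))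
    (h2 : ∀ m : ℕ, 1 + a - c ≠ -(m : ℂ))
    (h3 : ∀ m : ℕ, 1 + a / 2 ≠ -(m : ℂ))
    (h4 : ∀ m : ℕ, 1 + a / 2 - b - c ≠ -(m : ℂ))
    (h5 : ∀ m : ℕ, 1 + a ≠ -(m : ℂ))
    (h6 : ∀ m : ℕ, 1 + a / 2 - b ≠ -(m : ℂ))
    (h7 : ∀ m : ℕ, 1 + a / 2 - c ≠ -(m : ℂ))
    (h8 : ∀ m : ℕ, 1 + a - b - c ≠ -(m : ℂ)) :
    HasSum (fun k : ℕ =>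
        poch a k * poch b k * poch c k /
          (poch (1 + a - b) k * poch (1 + a - c) k * (Nat.factorial k : ℂ)))
      (Gamma (1 + a - b) * Gamma (1 + a - c) * Gamma (1 + a / 2) *
          Gamma (1 + a / 2 - b - c) /
        (Gamma (1 + a) * Gamma (1 + a / 2 - b) * Gamma (1 + a / 2 - c) *
          Gamma (1 + a - b - c))) := by
  change HasSum (hyp a b c (1 + a - b) (1 + a - c)) _
  rcases eq_or_ne a 0 with rfl | ha
  · have hterm : hyp 0 b c (1 + 0 - b) (1 + 0 - c) = fun k => if k = 0 then 1 else 0 := by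
      funext k
      rcases k with _ | k
      · simp [hyp_zero]
      · have : poch 0 (k + 1) = 0 := by
          rw [poch_eq_prod]
          exact prod_eq_zero (i := 0) (by simp) (by simp)
        simp [hyp, this]
    rw [hterm]
    convert hasSum_ite_eq (0 : ℕ) (1 : ℂ) using 1
    have g1 := Gamma_ne_zero h1
    have g2 := Gamma_ne_zero h2
    have g8 := Gamma_ne_zero h8
    simp only [add_zero, zero_div, Gamma_one] at *
    field_simp
  · have hs : Summable (hyp a b c (1 + a - b) (1 + a - c)) :=
      summable_hyp (by convert h using 2; ring)
    convert hs.hasSum using 1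
    have l1 := (tendsto_poch_ratio (u := 1 + a - b) (v := 1 + a - c) h5 h8 (by ring)).comp
      (tendsto_atTop_mono (fun n : ℕ => (by lia : n ≤ 2 * n + 1)) tendsto_id)
    have l2 := tendsto_poch_ratio (u := 1 + a / 2) (v := 1 + a / 2 - b - c) h6 h7 (by ring)
    have l3 := (tendsto_tsum_hyp a b c).comp (tendsto_add_atTop_nat 1)
    have l := (l1.mul l2).mul l3
    have hconst := l.congr fun n =>
      (tsum_hyp_add_two_mul h h1 h2 h3 h4 ha h5 (n + 1)).symm
    rw [← tendsto_nhds_unique hconst tendsto_const_nhds, mul_one, div_mul_div_comm]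
    congr 1 <;> ring
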